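/- arXiv:1901.05502 — 3 statements merged into one kernel-verified Lean document; each statement's English description precedes it below -/
import Mathlib

section
/- For every even m ≥ 4, there exists a signed magic rectangle SMR(m, 5m/2; 5, 2): an m × (5m/2) array using each of ±1, …, ±(5m/2) exactly once, with exactly 5 filled cells per row and 2 per column, and all row and column sums zero. -/
/-- The set of values used by a signed magic rectangle SMR(m,n;r,s):
`{0, ±1, …, ±(ms−1)/2}` if `m*r` is odd, and `{±1, …, ±(m*r/2)}` if `m*r` is even. -/
def SMRvalue (m r s : ℕ) (x : ℤ) : Prop :=
  if m * r % 2 = 1 then |x| ≤ ((m : ℤ) * s - 1) / 2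
  else x ≠ 0 ∧ |x| ≤ (m : ℤ) * r / 2

/-- `A` (a partially filled `m × n` integer array) is a signed magic rectangle
SMR(m,n;r,s): exactly `r` filled cells per row, `s` per column, every value of
the value set appears exactly once, all entries are values, and all row and
column sums are zero. -/
def IsSMR (m n r s : ℕ) (A : Fin m → Fin n → Option ℤ) : Prop :=
  (∀ i, (Finset.univ.filter fun j => (A i j).isSome).card = r) ∧
  (∀ j, (Finset.univ.filter fun i => (A i j).isSome).card = s) ∧
  (∀ i j x, A i j = some x → SMRvalue m r s x) ∧
  (∀ x : ℤ, SMRvalue m r s x → ∃! p : Fin m × Fin n, A p.1 p.2 = some x) ∧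
  (∀ i, ∑ j, (A i j).getD 0 = 0) ∧
  (∀ j, ∑ i, (A i j).getD 0 = 0)

/-- A signed magic rectangle SMR(m,n;r,s) exists. -/
def SMR (m n r s : ℕ) : Prop := ∃ A : Fin m → Fin n → Option ℤ, IsSMR m n r s A

/-- The array has equally many positive and negative entries in every row and
in every column. -/
def IsShiftable (m n : ℕ) (A : Fin m → Fin n → Option ℤ) : Prop :=
  (∀ i, (Finset.univ.filter fun j => 0 < (A i j).getD 0).card =
        (Finset.univ.filter fun j => (A i j).getD 0 < 0).card) ∧
  (∀ j, (Finset.univ.filter fun i => 0 < (A i j).getD 0).card =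
        (Finset.univ.filter fun i => (A i j).getD 0 < 0).card)

/-- A shiftable signed magic rectangle SMR(m,n;r,s) exists. -/
def ShiftableSMR (m n r s : ℕ) : Prop :=
  ∃ A : Fin m → Fin n → Option ℤ, IsSMR m n r s A ∧ IsShiftable m n A

/-- General reduction: columns are `{k, -k}`, rows are given by finsets. -/
lemma smr_of_rows (m n : ℕ) (hn : 2 * n = 5 * m) (S : Fin m → Finset ℤ) (ρ : ℤ → Fin m)
    (hcard : ∀ i, (S i).card = 5) (hsum : ∀ i, ∑ x ∈ S i, x = 0)
    (hval : ∀ i, ∀ x ∈ S i, x ≠ 0 ∧ |x| ≤ (n : ℤ))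
    (hneg : ∀ i, ∀ x ∈ S i, -x ∉ S i)
    (hρ : ∀ x : ℤ, x ≠ 0 → |x| ≤ (n : ℤ) → ∀ i, x ∈ S i ↔ i = ρ x) :
    SMR m n 5 2 := by
  have hV : ∀ x : ℤ, SMRvalue m 5 2 x ↔ (x ≠ 0 ∧ |x| ≤ (n : ℤ)) := by
    intro x
    unfold SMRvalue
    have h1 : ¬ (m * 5 % 2 = 1) := by omega
    have h2 : (m : ℤ) * (5 : ℕ) / 2 = n := by push_cast; omega
    rw [if_neg h1, h2]
  let A : Fin m → Fin n → Option ℤ := fun i j =>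
    if ((j : ℤ) + 1) ∈ S i then some ((j : ℤ) + 1)
    else if -((j : ℤ) + 1) ∈ S i then some (-((j : ℤ) + 1)) else none
  have hA : ∀ i j x, A i j = some x ↔ (x ∈ S i ∧ |x| = (j : ℤ) + 1) := by
    intro i j x
    have hj : (0 : ℤ) ≤ (j : ℤ) := by positivity
    have hj1 : |(j : ℤ) + 1| = (j : ℤ) + 1 := abs_of_nonneg (by omega)
    constructor
    · intro h
      simp only [A] at h
      split_ifs at h with h1 h2
      · obtain rfl := Option.some.inj h
        exact ⟨h1, hj1⟩
      · obtain rfl := Option.some.inj h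
        exact ⟨h2, by rw [abs_neg, hj1]⟩
    · rintro ⟨h1, h2⟩
      simp only [A]
      rcases abs_cases x with ⟨h3, _⟩ | ⟨h3, _⟩
      · have : x = (j : ℤ) + 1 := by omega
        rw [← this, if_pos h1]
      · have h4 : (j : ℤ) + 1 = -x := by omega
        rw [h4, if_neg (hneg i x h1), neg_neg, if_pos h1]
  have hS : ∀ i j, (A i j).isSome → A i j = some ((A i j).getD 0) := by
    intro i j h
    obtain ⟨x, hx⟩ := Option.isSome_iff_exists.1 h
    simp [hx]
  have hex : ∀ x : ℤ, x ≠ 0 → |x| ≤ (n : ℤ) → ∃ j : Fin n, |x| = (j : ℤ) + 1 := by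
    intro x h0 hx
    have : 0 < |x| := abs_pos.2 h0
    refine ⟨⟨(|x| - 1).toNat, by omega⟩, ?_⟩
    simp only []
    omega
  have hfin : ∀ j j' : Fin n, (j : ℤ) + 1 = (j' : ℤ) + 1 → j = j' := by
    intro j j' h
    apply Fin.ext
    omega
  have hjv : ∀ j : Fin n, ((j : ℤ) + 1 ≠ 0 ∧ |(j : ℤ) + 1| ≤ (n : ℤ)) ∧
      (-((j : ℤ) + 1) ≠ 0 ∧ |-((j : ℤ) + 1)| ≤ (n : ℤ)) := by
    intro j
    have := j.2
    have hj1 : |(j : ℤ) + 1| = (j : ℤ) + 1 := abs_of_nonneg (by omega)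
    rw [abs_neg, hj1]
    omega
  have hne : ∀ j : Fin n, ρ ((j : ℤ) + 1) ≠ ρ (-((j : ℤ) + 1)) := by
    intro j h
    obtain ⟨⟨a, b⟩, c, d⟩ := hjv j
    exact hneg _ _ ((hρ _ a b _).2 rfl) ((hρ _ c d _).2 h)
  refine ⟨A, ?_, ?_, ?_, ?_, ?_, ?_⟩
  · intro i
    rw [← hcard i]
    apply Finset.card_bij (fun j _ => (A i j).getD 0)
    · intro j hj
      exact ((hA _ _ _).1 (hS i j (by simpa using hj))).1
    · intro j hj j' hj' h
      have h1 := ((hA _ _ _).1 (hS i j (by simpa using hj))).2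
      have h2 := ((hA _ _ _).1 (hS i j' (by simpa using hj'))).2
      apply hfin
      rw [← h1, ← h2, h]
    · intro x hx
      obtain ⟨j, hj⟩ := hex x (hval i x hx).1 (hval i x hx).2
      have := (hA i j x).2 ⟨hx, hj⟩
      exact ⟨j, by simp [this], by simp [this]⟩
  · intro j
    obtain ⟨⟨a, b⟩, c, d⟩ := hjv j
    have : (Finset.univ.filter fun i => (A i j).isSome) =
        {ρ ((j : ℤ) + 1), ρ (-((j : ℤ) + 1))} := by
      ext i
      simp only [Finset.mem_filter, Finset.mem_univ, true_and, Finset.mem_insert,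
        Finset.mem_singleton, A]
      rw [← hρ _ a b, ← hρ _ c d]
      split_ifs with h1 h2
      · simp only [h1, true_or, Option.isSome_some]
      · simp only [h2, or_true, Option.isSome_some]
      · simp only [h1, h2, or_self, Option.isSome_none, Bool.false_eq_true]
    rw [this, Finset.card_pair (hne j)]
  · intro i j x h
    rw [hV]
    exact hval i x ((hA i j x).1 h).1
  · intro x hx
    rw [hV] at hx
    obtain ⟨j, hj⟩ := hex x hx.1 hx.2
    refine ⟨(ρ x, j), (hA _ _ _).2 ⟨(hρ x hx.1 hx.2 _).2 rfl, hj⟩, ?_⟩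
    rintro ⟨i', j'⟩ h
    obtain ⟨h1, h2⟩ := (hA _ _ _).1 h
    have e1 := (hρ x hx.1 hx.2 _).1 h1
    have e2 := hfin j' j (by rw [← h2, ← hj])
    simp only at e1 e2
    rw [e1, e2]
  · intro i
    have : ∑ j, (A i j).getD 0 =
        ∑ j ∈ Finset.univ.filter (fun j => (A i j).isSome), (A i j).getD 0 := by
      rw [Finset.sum_filter]
      apply Finset.sum_congr rfl
      intro j _
      cases A i j <;> simp
    rw [this]
    refine Eq.trans ?_ (hsum i)
    apply Finset.sum_bij (fun j _ => (A i j).getD 0)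
    · intro j hj
      exact ((hA _ _ _).1 (hS i j (by simpa using hj))).1
    · intro j hj j' hj' h
      have h1 := ((hA _ _ _).1 (hS i j (by simpa using hj))).2
      have h2 := ((hA _ _ _).1 (hS i j' (by simpa using hj'))).2
      apply hfin
      rw [← h1, ← h2, h]
    · intro x hx
      obtain ⟨j, hj⟩ := hex x (hval i x hx).1 (hval i x hx).2
      have := (hA i j x).2 ⟨hx, hj⟩
      exact ⟨j, by simp [this], by simp [this]⟩
    · intro j _
      rfl
  · intro j
    obtain ⟨⟨a, b⟩, c, d⟩ := hjv j
    have : ∀ i, (A i j).getD 0 = (if i = ρ ((j : ℤ) + 1) then ((j : ℤ) + 1) else 0) +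
        (if i = ρ (-((j : ℤ) + 1)) then -((j : ℤ) + 1) else 0) := by
      intro i
      have := hneg i ((j : ℤ) + 1)
      simp only [← hρ _ a b, ← hρ _ c d, A]
      split_ifs with h1 h2 <;> simp_all
    simp only [this, Finset.sum_add_distrib, Finset.sum_ite_eq', Finset.mem_univ, if_true,
      Finset.sum_ite_eq]
    ring

/-- Transposition of `1` and `2`. -/
def swp (j : ℤ) : ℤ := if j = 1 then 2 else if j = 2 then 1 else j

/-- The rows of the construction (`j = i + 1` or `j = i - t + 1`). -/
def rowSet (t i : ℤ) : Finset ℤ :=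
  if i < t then
    {i + 1, t + (i + 1), -(t + 2 * swp (i + 1) - 1), 3 * t + 2 * swp (i + 1) - 1,
      -(3 * t + 2 * (i + 1))}
  else
    {-(i - t + 1), 3 * t + 1 - (i - t + 1), -(3 * t + 2 - 2 * swp (i - t + 1)),
      3 * t + 2 * (i - t + 1), -(3 * t + 2 * swp (i - t + 1) - 1)}

/-- The row containing a given value. -/
def rowOf (t x : ℤ) : ℤ :=
  if 0 < x then
    if x ≤ t then x - 1
    else if x ≤ 2 * t then x - t - 1
    else if x ≤ 3 * t then 4 * t - x
    else if (x - 3 * t) % 2 = 0 then t + (x - 3 * t) / 2 - 1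
    else swp ((x - 3 * t + 1) / 2) - 1
  else
    if -x ≤ t then t - x - 1
    else if -x ≤ 3 * t then
      if (-x - t) % 2 = 0 then t + swp ((3 * t + 2 + x) / 2) - 1
      else swp ((-x - t + 1) / 2) - 1
    else if (-x - 3 * t) % 2 = 0 then (-x - 3 * t) / 2 - 1
    else t + swp ((-x - 3 * t + 1) / 2) - 1

lemma swp_spec (j : ℤ) : (j = 1 ∧ swp j = 2) ∨ (j = 2 ∧ swp j = 1) ∨
    (j ≠ 1 ∧ j ≠ 2 ∧ swp j = j) := by
  unfold swp; split_ifs <;> omega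

lemma swp_swp (j : ℤ) : swp (swp j) = j := by
  unfold swp; split_ifs <;> omega

lemma rowOf_bound (t x : ℤ) (ht : 2 ≤ t) (h0 : x ≠ 0) (h1 : x ≤ 5 * t) (h2 : -x ≤ 5 * t) :
    0 ≤ rowOf t x ∧ rowOf t x < 2 * t := by
  unfold rowOf swp
  split_ifs <;> omega

lemma mem_rowOf (t x : ℤ) (ht : 2 ≤ t) (h0 : x ≠ 0) (h1 : x ≤ 5 * t) (h2 : -x ≤ 5 * t) :
    x ∈ rowSet t (rowOf t x) := by
  unfold rowOf rowSet
  split_ifs <;> simp only [Finset.mem_insert, Finset.mem_singleton] <;>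
    (try unfold swp at *) <;> (try split_ifs at *) <;> omega

set_option maxHeartbeats 4000000 in
lemma rowOf_mem (t x i : ℤ) (ht : 2 ≤ t) (hi : 0 ≤ i) (hi2 : i < 2 * t)
    (hx : x ∈ rowSet t i) : i = rowOf t x := by
  unfold rowSet at hx
  split_ifs at hx with h <;> simp only [Finset.mem_insert, Finset.mem_singleton] at hx <;>
    rcases hx with hx | hx | hx | hx | hx <;>
    (try unfold swp at hx) <;> unfold rowOf swp <;> (try split_ifs at hx) <;> split_ifs <;> omega

lemma rowSet_val (t x i : ℤ) (ht : 2 ≤ t) (hi : 0 ≤ i) (hi2 : i < 2 * t)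
    (hx : x ∈ rowSet t i) : x ≠ 0 ∧ x ≤ 5 * t ∧ -x ≤ 5 * t := by
  unfold rowSet at hx
  have e1 := swp_spec (i + 1)
  have e2 := swp_spec (i - t + 1)
  split_ifs at hx with h <;> simp only [Finset.mem_insert, Finset.mem_singleton] at hx <;> omega

lemma rowSet_neg (t x i : ℤ) (ht : 2 ≤ t) (hi : 0 ≤ i) (hi2 : i < 2 * t)
    (hx : x ∈ rowSet t i) : -x ∉ rowSet t i := by
  intro hy
  unfold rowSet at hx hy
  have e1 := swp_spec (i + 1)
  have e2 := swp_spec (i - t + 1)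
  split_ifs at hx hy with h <;>
    simp only [Finset.mem_insert, Finset.mem_singleton] at hx hy <;>
    rcases hx with hx | hx | hx | hx | hx <;> omega

lemma five_set (a b c d e : ℤ) (h1 : a ≠ b ∧ a ≠ c ∧ a ≠ d ∧ a ≠ e) (h2 : b ≠ c ∧ b ≠ d ∧ b ≠ e)
    (h3 : c ≠ d ∧ c ≠ e) (h4 : d ≠ e) :
    ({a, b, c, d, e} : Finset ℤ).card = 5 ∧
      ∑ x ∈ ({a, b, c, d, e} : Finset ℤ), x = a + b + c + d + e := by
  constructor
  · rw [Finset.card_insert_of_notMem, Finset.card_insert_of_notMem, Finset.card_insert_of_notMem,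
      Finset.card_pair h4] <;> simp <;> tauto
  · rw [Finset.sum_insert, Finset.sum_insert, Finset.sum_insert, Finset.sum_pair h4]
    · ring
    all_goals simp <;> tauto

lemma rowSet_card_sum (t i : ℤ) (ht : 2 ≤ t) (hi : 0 ≤ i) (hi2 : i < 2 * t) :
    (rowSet t i).card = 5 ∧ ∑ x ∈ rowSet t i, x = 0 := by
  unfold rowSet
  have e1 := swp_spec (i + 1)
  have e2 := swp_spec (i - t + 1)
  split_ifs with h
  · obtain ⟨h1, h2⟩ := five_set (i + 1) (t + (i + 1)) (-(t + 2 * swp (i + 1) - 1))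
      (3 * t + 2 * swp (i + 1) - 1) (-(3 * t + 2 * (i + 1)))
      (by omega) (by omega) (by omega) (by omega)
    exact ⟨h1, by rw [h2]; omega⟩
  · obtain ⟨h1, h2⟩ := five_set (-(i - t + 1)) (3 * t + 1 - (i - t + 1))
      (-(3 * t + 2 - 2 * swp (i - t + 1)))
      (3 * t + 2 * (i - t + 1)) (-(3 * t + 2 * swp (i - t + 1) - 1))
      (by omega) (by omega) (by omega) (by omega)
    exact ⟨h1, by rw [h2]; omega⟩

theorem stmt_8 (m n : ℕ) (hm : Even m) (h4 : 4 ≤ m) (hn : 2 * n = 5 * m) :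
    SMR m n 5 2 := by
  obtain ⟨t, rfl⟩ := hm
  have ht : (2 : ℤ) ≤ t := by omega
  have hlt : ∀ i : Fin (t + t), (0 : ℤ) ≤ (i : ℤ) ∧ (i : ℤ) < 2 * t := by
    intro i
    have := i.2
    omega
  have hne : NeZero (t + t) := ⟨by omega⟩
  refine smr_of_rows (t + t) n hn (fun i => rowSet t i)
    (fun x => Fin.ofNat (t + t) (rowOf t x).toNat) ?_ ?_ ?_ ?_ ?_
  · intro i
    exact (rowSet_card_sum t i ht (hlt i).1 (hlt i).2).1
  · intro i
    exact (rowSet_card_sum t i ht (hlt i).1 (hlt i).2).2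
  · intro i x hx
    obtain ⟨a, b, c⟩ := rowSet_val t x i ht (hlt i).1 (hlt i).2 hx
    exact ⟨a, abs_le.2 (by omega)⟩
  · intro i x hx
    exact rowSet_neg t x i ht (hlt i).1 (hlt i).2 hx
  · intro x h0 hx i
    rw [abs_le] at hx
    have hb := rowOf_bound t x ht h0 (by omega) (by omega)
    have hv : ((Fin.ofNat (t + t) (rowOf t x).toNat : Fin (t + t)) : ℕ) = (rowOf t x).toNat := by
      simp only [Fin.ofNat]
      exact Nat.mod_eq_of_lt (by omega)
    constructor
    · intro h
      have := rowOf_mem t x i ht (hlt i).1 (hlt i).2 h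
      apply Fin.ext
      rw [hv]
      omega
    · intro h
      have h2 : (i : ℤ) = rowOf t x := by
        rw [h, hv]
        omega
      show x ∈ rowSet t i
      rw [h2]
      exact mem_rowOf t x ht h0 (by omega) (by omega)
end

section
/- For all integers a, b ≥ 1, there exists a signed magic rectangle SMR(4b, 2b(4a+3); 4a+3, 2). -/
/-- Row labels `P j`, `Q j` of the entries `j+1` and `-(j+1)` in column `j`. -/
def GoodRows (m N r : ℕ) (P Q : ℕ → ℕ) : Prop :=
  (∀ j, j < N → P j < m ∧ Q j < m ∧ P j ≠ Q j) ∧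
  (∀ i, i < m → ((Finset.range N).filter fun j => P j = i).card
      + ((Finset.range N).filter fun j => Q j = i).card = r) ∧
  (∀ i, i < m → ∑ j ∈ (Finset.range N).filter (fun j => P j = i), ((j : ℤ) + 1)
      = ∑ j ∈ (Finset.range N).filter (fun j => Q j = i), ((j : ℤ) + 1))

theorem good_base (M : ℕ) : ∃ P Q, GoodRows (2 * M) (3 * M) 3 P Q := by
  refine ⟨fun j => if j < M then M + (M - 1 - j) else
      if (j - M) % 2 = 1 then (j - M) / 2 else M + (j - M) / 2,
    fun j => if j < M then j else j - M, ?_⟩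
  have key : ∀ i, i < 2 * M → ∃ S T : Finset ℕ,
      ((Finset.range (3 * M)).filter fun j => (if j < M then M + (M - 1 - j) else
      if (j - M) % 2 = 1 then (j - M) / 2 else M + (j - M) / 2) = i) = S ∧
      ((Finset.range (3 * M)).filter fun j => (if j < M then j else j - M) = i) = T ∧
      S.card + T.card = 3 ∧ ∑ j ∈ S, ((j : ℤ) + 1) = ∑ j ∈ T, ((j : ℤ) + 1) := by
    intro i hi
    by_cases h : i < M
    · refine ⟨{M + 2 * i + 1}, {i, M + i}, ?_, ?_, ?_, ?_⟩
      · ext j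
        simp only [Finset.mem_filter, Finset.mem_range, Finset.mem_singleton]
        split_ifs <;> omega
      · ext j
        simp only [Finset.mem_filter, Finset.mem_range, Finset.mem_singleton, Finset.mem_insert]
        split_ifs <;> omega
      · rw [Finset.card_pair (by omega)]; simp
      · rw [Finset.sum_pair (by omega)]; simp; ring
    · obtain ⟨k, rfl⟩ : ∃ k, i = M + k := ⟨i - M, by omega⟩
      refine ⟨{M + 2 * k, M - k - 1}, {2 * M + k}, ?_, ?_, ?_, ?_⟩
      · ext j
        simp only [Finset.mem_filter, Finset.mem_range, Finset.mem_singleton, Finset.mem_insert]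
        split_ifs <;> omega
      · ext j
        simp only [Finset.mem_filter, Finset.mem_range, Finset.mem_singleton]
        split_ifs <;> omega
      · rw [Finset.card_pair (by omega)]; simp
      · rw [Finset.sum_pair (by omega)]; simp; omega
  refine ⟨?_, ?_, ?_⟩
  · intro j hj
    dsimp only
    split_ifs <;> omega
  · intro i hi
    obtain ⟨S, T, hS, hT, h1, h2⟩ := key i hi
    rw [hS, hT, h1]
  · intro i hi
    obtain ⟨S, T, hS, hT, h1, h2⟩ := key i hi
    rw [hS, hT, h2]

theorem good_step (b N r : ℕ) (h : ∃ P Q, GoodRows (4 * b) N r P Q) :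
    ∃ P Q, GoodRows (4 * b) (N + 8 * b) (r + 4) P Q := by
  obtain ⟨P, Q, h1, h2, h3⟩ := h
  let P' : ℕ → ℕ := fun j => if j < N then P j else
    if (j - N) % 4 = 0 ∨ (j - N) % 4 = 3 then 2 * ((j - N) / 4) else 2 * ((j - N) / 4) + 1
  let Q' : ℕ → ℕ := fun j => if j < N then Q j else
    if (j - N) % 4 = 0 ∨ (j - N) % 4 = 3 then 2 * ((j - N) / 4) + 1 else 2 * ((j - N) / 4)
  have key : ∀ i, i < 4 * b → ∃ S T : Finset ℕ,
      ((Finset.range (N + 8 * b)).filter fun j => P' j = i)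
        = ((Finset.range N).filter fun j => P j = i) ∪ S ∧
      ((Finset.range (N + 8 * b)).filter fun j => Q' j = i)
        = ((Finset.range N).filter fun j => Q j = i) ∪ T ∧
      (∀ j ∈ S, N ≤ j) ∧ (∀ j ∈ T, N ≤ j) ∧
      S.card = 2 ∧ T.card = 2 ∧ ∑ j ∈ S, ((j : ℤ) + 1) = ∑ j ∈ T, ((j : ℤ) + 1) := by
    intro i hi
    obtain ⟨q, hq⟩ : ∃ q, i = 2 * q ∨ i = 2 * q + 1 := ⟨i / 2, by omega⟩
    rcases hq with rfl | rfl
    · refine ⟨{N + 4 * q, N + 4 * q + 3}, {N + 4 * q + 1, N + 4 * q + 2}, ?_, ?_, ?_, ?_,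
        Finset.card_pair (by omega), Finset.card_pair (by omega), ?_⟩
      · ext j
        simp only [P', Finset.mem_filter, Finset.mem_range, Finset.mem_singleton,
          Finset.mem_insert, Finset.mem_union]
        split_ifs <;> omega
      · ext j
        simp only [Q', Finset.mem_filter, Finset.mem_range, Finset.mem_singleton,
          Finset.mem_insert, Finset.mem_union]
        split_ifs <;> omega
      · simp; omega
      · simp; omega
      · rw [Finset.sum_pair (by omega), Finset.sum_pair (by omega)]; push_cast; ring
    · refine ⟨{N + 4 * q + 1, N + 4 * q + 2}, {N + 4 * q, N + 4 * q + 3}, ?_, ?_, ?_, ?_,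
        Finset.card_pair (by omega), Finset.card_pair (by omega), ?_⟩
      · ext j
        simp only [P', Finset.mem_filter, Finset.mem_range, Finset.mem_singleton,
          Finset.mem_insert, Finset.mem_union]
        split_ifs <;> omega
      · ext j
        simp only [Q', Finset.mem_filter, Finset.mem_range, Finset.mem_singleton,
          Finset.mem_insert, Finset.mem_union]
        split_ifs <;> omega
      · simp; omega
      · simp; omega
      · rw [Finset.sum_pair (by omega), Finset.sum_pair (by omega)]; push_cast; ring
  have disj : ∀ (R : ℕ → ℕ) (i : ℕ) (S : Finset ℕ), (∀ j ∈ S, N ≤ j) →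
      Disjoint ((Finset.range N).filter fun j => R j = i) S := by
    intro R i S hS
    rw [Finset.disjoint_left]
    intro j hj hj'
    have := hS j hj'
    simp only [Finset.mem_filter, Finset.mem_range] at hj
    omega
  refine ⟨P', Q', ?_, ?_, ?_⟩
  · intro j hj
    by_cases hN : j < N
    · simpa [P', Q', hN] using h1 j hN
    · simp only [P', Q', hN, if_false]
      split_ifs <;> omega
  · intro i hi
    obtain ⟨S, T, hS, hT, hS', hT', c1, c2, _⟩ := key i hi
    rw [hS, hT, Finset.card_union_of_disjoint (disj _ _ _ hS'),
      Finset.card_union_of_disjoint (disj _ _ _ hT')]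
    have := h2 i hi
    omega
  · intro i hi
    obtain ⟨S, T, hS, hT, hS', hT', _, _, e⟩ := key i hi
    rw [hS, hT, Finset.sum_union (disj _ _ _ hS'), Finset.sum_union (disj _ _ _ hT'),
      h3 i hi, e]

theorem good_all (a b : ℕ) :
    ∃ P Q, GoodRows (4 * b) (2 * b * (4 * a + 3)) (4 * a + 3) P Q := by
  induction a with
  | zero =>
    have := good_base (2 * b)
    rw [show 2 * (2 * b) = 4 * b by ring, show 3 * (2 * b) = 2 * b * (4 * 0 + 3) by ring] at this
    exact this
  | succ a ih =>
    have := good_step b _ _ ih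
    rw [show 2 * b * (4 * a + 3) + 8 * b = 2 * b * (4 * (a + 1) + 3) by ring] at this
    exact this

theorem fin_filter_card (N : ℕ) (p : ℕ → Prop) [DecidablePred p] :
    (Finset.univ.filter fun j : Fin N => p j).card = ((Finset.range N).filter p).card := by
  rw [Finset.card_filter, Finset.card_filter,
    ← Fin.sum_univ_eq_sum_range (fun j => if p j then 1 else 0)]

theorem stmt_13 (a b : ℕ) (ha : 1 ≤ a) (hb : 1 ≤ b) :
    SMR (4 * b) (2 * b * (4 * a + 3)) (4 * a + 3) 2 := by
  obtain ⟨P, Q, h1, h2, h3⟩ := good_all a b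
  have hval : ∀ x, SMRvalue (4 * b) (4 * a + 3) 2 x ↔
      x ≠ 0 ∧ |x| ≤ ((2 * b * (4 * a + 3) : ℕ) : ℤ) := by
    intro x
    have e1 : (4 * b) * (4 * a + 3) % 2 ≠ 1 := by
      rw [show (4 * b) * (4 * a + 3) = 2 * (2 * b * (4 * a + 3)) by ring]; omega
    have e2 : ((4 * b : ℕ) : ℤ) * ((4 * a + 3 : ℕ) : ℤ) / 2
        = ((2 * b * (4 * a + 3) : ℕ) : ℤ) := by
      rw [show ((4 * b : ℕ) : ℤ) * ((4 * a + 3 : ℕ) : ℤ)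
        = 2 * ((2 * b * (4 * a + 3) : ℕ) : ℤ) by push_cast; ring]
      omega
    rw [SMRvalue, if_neg e1, e2]
  generalize 2 * b * (4 * a + 3) = N at *
  generalize 4 * a + 3 = r at *
  generalize 4 * b = m at *
  let A : Fin m → Fin N → Option ℤ := fun i j =>
    if P j = i then some ((j : ℤ) + 1) else if Q j = i then some (-((j : ℤ) + 1)) else none
  have hsome : ∀ i j x, A i j = some x ↔
      (P j = i ∧ x = (j : ℤ) + 1) ∨ (Q j = i ∧ x = -((j : ℤ) + 1)) := by
    intro i j x
    have := (h1 j j.2).2.2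
    simp only [A]
    split_ifs with u v
    · simp only [Option.some.injEq]; omega
    · simp only [Option.some.injEq]; omega
    · simp; omega
  have hiss : ∀ i j, (A i j).isSome = true ↔ P j = i ∨ Q j = i := by
    intro i j
    simp only [A]
    split_ifs <;> simp_all
  have hget : ∀ i j, (A i j).getD 0 =
      (if P j = i then ((j : ℕ) : ℤ) + 1 else 0) - (if Q j = i then ((j : ℕ) : ℤ) + 1 else 0) := by
    intro i j
    have := (h1 j j.2).2.2
    simp only [A]
    split_ifs <;> first | omega | simp
  refine ⟨A, ?_, ?_, ?_, ?_, ?_, ?_⟩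
  · intro i
    simp only [hiss]
    rw [Finset.filter_or, Finset.card_union_of_disjoint, fin_filter_card N (fun j => P j = i),
      fin_filter_card N (fun j => Q j = i), h2 i i.2]
    rw [Finset.disjoint_left]
    intro j hj hj'
    have := (h1 j j.2).2.2
    simp only [Finset.mem_filter] at hj hj'
    omega
  · intro j
    simp only [hiss]
    obtain ⟨p, q, e⟩ := h1 j j.2
    have : (Finset.univ.filter fun i : Fin m => P j = i ∨ Q j = i)
        = {(⟨P j, p⟩ : Fin m), ⟨Q j, q⟩} := by
      ext i
      simp only [Finset.mem_filter, Finset.mem_univ, true_and, Finset.mem_insert,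
        Finset.mem_singleton, Fin.ext_iff]
      omega
    rw [this, Finset.card_pair (by simpa [Fin.ext_iff] using e)]
  · intro i j x hx
    rw [hsome] at hx
    rw [hval]
    have := j.2
    rw [abs_le]
    omega
  · intro x hx
    rw [hval, abs_le] at hx
    obtain ⟨k, hk, hkx⟩ : ∃ k : ℕ, k < N ∧ (x = k + 1 ∨ x = -(k + 1)) :=
      ⟨x.natAbs - 1, by omega, by omega⟩
    obtain ⟨p, q, e⟩ := h1 k hk
    rcases hkx with hkx | hkx
    · refine ⟨(⟨P k, p⟩, ⟨k, hk⟩), ?_, ?_⟩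
      · simp only [hsome]; left; exact ⟨by simp, hkx⟩
      · rintro ⟨i, j⟩ hij
        simp only [hsome] at hij
        have hjk : (j : ℕ) = k := by omega
        rw [hjk] at hij
        simp only [Prod.mk.injEq, Fin.ext_iff]
        omega
    · refine ⟨(⟨Q k, q⟩, ⟨k, hk⟩), ?_, ?_⟩
      · simp only [hsome]; right; exact ⟨by simp, hkx⟩
      · rintro ⟨i, j⟩ hij
        simp only [hsome] at hij
        have hjk : (j : ℕ) = k := by omega
        rw [hjk] at hij
        simp only [Prod.mk.injEq, Fin.ext_iff]
        omega
  · intro i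
    simp only [hget]
    rw [Finset.sum_sub_distrib,
      Fin.sum_univ_eq_sum_range (fun j => if P j = i then (j : ℤ) + 1 else 0),
      Fin.sum_univ_eq_sum_range (fun j => if Q j = i then (j : ℤ) + 1 else 0),
      ← Finset.sum_filter, ← Finset.sum_filter, h3 i i.2, sub_self]
  · intro j
    obtain ⟨p, q, e⟩ := h1 j j.2
    simp only [hget]
    rw [Finset.sum_sub_distrib]
    have aux : ∀ c, c < m → ∑ i : Fin m, (if c = (i : ℕ) then ((j : ℕ) : ℤ) + 1 else 0)
        = (j : ℕ) + 1 := by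
      intro c hc
      rw [Finset.sum_eq_single (⟨c, hc⟩ : Fin m)]
      · simp
      · intro i _ hi
        rw [if_neg]
        intro h
        exact hi (Fin.ext h.symm)
      · simp
    rw [aux _ p, aux _ q, sub_self]
end

section
/- For every even m with either m = 2 and n = r ≡ 0, 3 (mod 4), or m ≥ 4, r ≥ 3 and mr = 2n, there exists a signed magic rectangle SMR(m,n;r,2); conversely these are the only such parameters with m even. -/
/-! A signed magic rectangle with two entries per column is the same as a loopless `r`-regular
directed multigraph on `m` vertices with edges labelled bijectively by `1..n` such that
Kirchhoff's law holds at every vertex. -/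

structure Net {V E : Type} [Fintype E] [DecidableEq V] (r : ℕ) (p q : E → V) (l : E → ℤ) :
    Prop where
  ne : ∀ e, p e ≠ q e
  deg : ∀ v, ∑ e, ((if p e = v then 1 else 0) + (if q e = v then 1 else 0)) = r
  flow : ∀ v, ∑ e, ((if p e = v then l e else 0) - (if q e = v then l e else 0)) = 0

/-- There is a full conservative labelling on the vertex type `V`. -/
def Q (V : Type) [Fintype V] [DecidableEq V] (r : ℕ) : Prop :=
  ∃ (E : Type) (_ : Fintype E) (p q : E → V) (l : E → ℤ), Net r p q l ∧ Function.Injective l ∧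
    ∀ e, 1 ≤ l e ∧ 2 * l e ≤ (Fintype.card V : ℤ) * r

theorem Net.congrV {V V' E : Type} [Fintype E] [DecidableEq V] [DecidableEq V'] {r : ℕ}
    {p q : E → V} {l : E → ℤ} (h : Net r p q l) (f : V ≃ V') :
    Net r (fun e => f (p e)) (fun e => f (q e)) l := by
  refine ⟨fun e he => h.ne e (f.injective he), fun v => ?_, fun v => ?_⟩
  · rw [← h.deg (f.symm v)]
    simp only [Equiv.eq_symm_apply]
  · refine Eq.trans ?_ (h.flow (f.symm v))
    simp only [Equiv.eq_symm_apply]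

theorem Net.congrE {V E E' : Type} [Fintype E] [Fintype E'] [DecidableEq V] {r : ℕ}
    {p q : E → V} {l : E → ℤ} (h : Net r p q l) (f : E' ≃ E) :
    Net r (fun e => p (f e)) (fun e => q (f e)) (fun e => l (f e)) := by
  refine ⟨fun e => h.ne _, fun v => ?_, fun v => ?_⟩
  · rw [← h.deg v]
    exact Equiv.sum_comp f (fun e => ((if p e = v then 1 else 0) + (if q e = v then 1 else 0)))
  · refine Eq.trans ?_ (h.flow v)
    exact Equiv.sum_comp f (fun e => ((if p e = v then l e else 0) - (if q e = v then l e else 0)))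

theorem Q.congr {V V' : Type} [Fintype V] [DecidableEq V] [Fintype V'] [DecidableEq V'] {r : ℕ}
    (h : Q V r) (hc : Fintype.card V = Fintype.card V') : Q V' r := by
  obtain ⟨E, hE, p, q, l, hn, hi, hl⟩ := h
  refine ⟨E, hE, _, _, l, hn.congrV (Fintype.equivOfCardEq hc), hi, ?_⟩
  rw [← hc]; exact hl

theorem Net.union {V W E F : Type} [Fintype E] [Fintype F] [DecidableEq V] [DecidableEq W] {r : ℕ}
    {p q : E → V} {l : E → ℤ} {p' q' : F → W} {l' : F → ℤ}
    (h : Net r p q l) (h' : Net r p' q' l') :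
    Net r (Sum.map p p') (Sum.map q q') (Sum.elim l l') := by
  refine ⟨?_, ?_, ?_⟩
  · rintro (e | e)
    · simpa using h.ne e
    · simpa using h'.ne e
  · rintro (v | v)
    · simpa using h.deg v
    · simpa using h'.deg v
  · rintro (v | v)
    · simpa using h.flow v
    · simpa using h'.flow v

theorem Net.add {V E F : Type} [Fintype E] [Fintype F] [DecidableEq V] {r r' : ℕ}
    {p q : E → V} {l : E → ℤ} {p' q' : F → V} {l' : F → ℤ}
    (h : Net r p q l) (h' : Net r' p' q' l') :
    Net (r + r') (Sum.elim p p') (Sum.elim q q') (Sum.elim l l') := by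
  refine ⟨?_, ?_, ?_⟩
  · rintro (e | e)
    · simpa using h.ne e
    · simpa using h'.ne e
  · intro v
    rw [Fintype.sum_sum_type, ← h.deg v, ← h'.deg v]
    rfl
  · intro v
    rw [Fintype.sum_sum_type]
    have h1 := h.flow v
    have h2 := h'.flow v
    exact (congrArg₂ (· + ·) h1 h2).trans (add_zero 0)

theorem Net.family {I V E : Type} [Fintype I] [DecidableEq I] [Fintype E] [DecidableEq V] {r : ℕ}
    {p q : E → V} {l : I → E → ℤ} (h : ∀ i, Net r p q (l i)) :
    Net r (fun x : I × E => (x.1, p x.2)) (fun x : I × E => (x.1, q x.2))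
      (fun x : I × E => l x.1 x.2) := by
  refine ⟨?_, ?_, ?_⟩
  · rintro ⟨i, e⟩ he
    exact (h i).ne e (Prod.ext_iff.1 he).2
  · rintro ⟨i, v⟩
    rw [Fintype.sum_prod_type, Finset.sum_eq_single i, ← (h i).deg v]
    · simp
    · intro j _ hj
      simp [hj]
    · simp
  · rintro ⟨i, v⟩
    rw [Fintype.sum_prod_type, Finset.sum_eq_single i]
    · refine Eq.trans ?_ ((h i).flow v)
      simp
    · intro j _ hj
      simp [hj]
    · simp

theorem Net.card {V E : Type} [Fintype V] [Fintype E] [DecidableEq V] {r : ℕ}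
    {p q : E → V} {l : E → ℤ} (h : Net r p q l) :
    Fintype.card V * r = 2 * Fintype.card E := by
  have h1 : ∑ v : V, ∑ e : E, ((if p e = v then 1 else 0) + (if q e = v then 1 else 0))
      = ∑ _v : V, r := Finset.sum_congr rfl (fun v _ => h.deg v)
  rw [Finset.sum_comm] at h1
  simp [Finset.sum_add_distrib] at h1
  omega

theorem smr_of_net {m n r : ℕ} (hmn : m * r = 2 * n) {p q : Fin n → Fin m} {l : Fin n → ℤ}
    (h : Net r p q l) (hi : Function.Injective l) (hl : ∀ e, 1 ≤ l e ∧ l e ≤ n) :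
    SMR m n r 2 := by
  have hv : ∀ x, SMRvalue m r 2 x ↔ x ≠ 0 ∧ |x| ≤ n := by
    intro x
    have h1 : (m : ℤ) * r = 2 * n := by exact_mod_cast hmn
    have h2 : ¬ (m * r % 2 = 1) := by omega
    unfold SMRvalue
    rw [if_neg h2, h1]
    simp
  have hsurj : ∀ x : ℤ, 1 ≤ x → x ≤ n → ∃ j, l j = x := by
    intro x h1 h2
    have hc : (Finset.univ.image l) = Finset.Icc (1 : ℤ) n := by
      apply Finset.eq_of_subset_of_card_le
      · intro y hy
        obtain ⟨e, -, rfl⟩ := Finset.mem_image.1 hy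
        exact Finset.mem_Icc.2 (hl e)
      · rw [Finset.card_image_of_injective _ hi]
        simp
    have : x ∈ Finset.univ.image l := by rw [hc]; exact Finset.mem_Icc.2 ⟨h1, h2⟩
    obtain ⟨e, -, he⟩ := Finset.mem_image.1 this
    exact ⟨e, he⟩
  refine ⟨fun i j => if p j = i then some (l j) else if q j = i then some (-l j) else none,
    ?_, ?_, ?_, ?_, ?_, ?_⟩
  · intro i
    rw [Finset.card_filter, ← h.deg i]
    refine Finset.sum_congr rfl fun j _ => ?_
    have := h.ne j
    by_cases h1 : p j = i <;> by_cases h2 : q j = i <;> simp_all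
  · intro j
    have : (Finset.univ.filter fun i => ((if p j = i then some (l j) else
        if q j = i then some (-l j) else none : Option ℤ)).isSome) = {p j, q j} := by
      ext i
      simp only [Finset.mem_filter, Finset.mem_univ, true_and, Finset.mem_insert,
        Finset.mem_singleton]
      split_ifs with h1 h2
      · simp [h1]
      · simp [h2]
      · simp [Ne.symm h1, Ne.symm h2]
    rw [this, Finset.card_pair (h.ne j)]
  · intro i j x hx
    rw [hv]
    have := hl j
    dsimp only at hx
    split_ifs at hx <;> simp at hx <;> subst hx
    · rw [abs_le]; omega
    · rw [abs_le]; omega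
  · intro x hx
    rw [hv, abs_le] at hx
    obtain ⟨h0, h1, h2⟩ := hx
    rcases lt_or_gt_of_ne h0 with hx | hx
    · obtain ⟨j, hj⟩ := hsurj (-x) (by omega) (by omega)
      refine ⟨(q j, j), ?_, ?_⟩
      · simp [h.ne j, hj]
      · rintro ⟨i, k⟩ hk
        have := hl k
        dsimp only at hk
        split_ifs at hk with h3 h4 <;> simp at hk
        · omega
        · have : k = j := hi (by omega)
          subst this
          rw [h4]
    · obtain ⟨j, hj⟩ := hsurj x (by omega) (by omega)
      refine ⟨(p j, j), ?_, ?_⟩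
      · simp [hj]
      · rintro ⟨i, k⟩ hk
        have := hl k
        dsimp only at hk
        split_ifs at hk with h3 h4 <;> simp at hk
        · have : k = j := hi (by omega)
          subst this
          rw [h3]
        · omega
  · intro i
    refine Eq.trans ?_ (h.flow i)
    refine Finset.sum_congr rfl fun j _ => ?_
    have := h.ne j
    by_cases h1 : p j = i <;> by_cases h2 : q j = i <;> simp_all
  · intro j
    have : ∀ i, ((if p j = i then some (l j) else
        if q j = i then some (-l j) else none : Option ℤ)).getD 0
        = (if p j = i then l j else 0) + (if q j = i then - l j else 0) := by
      intro i
      have := h.ne j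
      by_cases h1 : p j = i <;> by_cases h2 : q j = i <;> simp_all
    simp only [this, Finset.sum_add_distrib]
    simp

theorem smr_of_Q {m n r : ℕ} (hmn : m * r = 2 * n) (h : Q (Fin m) r) : SMR m n r 2 := by
  obtain ⟨E, hE, p, q, l, hn, hi, hl⟩ := h
  have hc := hn.card
  simp only [Fintype.card_fin] at hc hl
  have f : Fin n ≃ E := Fintype.equivOfCardEq (by simp; omega)
  have h1 : (m : ℤ) * r = 2 * n := by exact_mod_cast hmn
  refine smr_of_net hmn (hn.congrE f) (hi.comp f.injective) fun e => ?_
  have := hl (f e)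
  constructor
  · exact this.1
  · have := this.2; omega

/-- Adding four to the degree. -/
theorem net_pair4 (c : ℤ) : Net (V := Fin 2) (E := Fin 4) 4 ![0, 1, 1, 0] ![1, 0, 0, 1]
    ![c, c + 1, c + 2, c + 3] := by
  refine ⟨by decide, by decide, ?_⟩
  intro v
  fin_cases v <;> simp [Fin.sum_univ_four] <;> ring

theorem Q.add4 {K r : ℕ} (h : Q (Fin K × Fin 2) r) : Q (Fin K × Fin 2) (r + 4) := by
  obtain ⟨E, hE, p, q, l, hn, hi, hl⟩ := h
  have h2 := Net.family (I := Fin K) (fun i => net_pair4 ((K : ℤ) * r + 4 * (i.1 : ℤ) + 1))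
  refine ⟨_, _, _, _, _, hn.add h2, ?_, ?_⟩
  · apply Function.Injective.sumElim hi
    · rintro ⟨i, a⟩ ⟨j, b⟩ hab
      obtain ⟨i, h_i⟩ := i
      obtain ⟨j, h_j⟩ := j
      fin_cases a <;> fin_cases b <;> simp at hab ⊢ <;> omega
    · rintro e ⟨i, a⟩ hab
      have := (hl e).2
      simp at this
      have : l e ≤ (K : ℤ) * r := by linarith
      fin_cases a <;> simp at hab <;> omega
  · rintro (e | ⟨i, a⟩)
    · have := hl e
      simp at this ⊢
      constructor
      · omega
      · nlinarith
    · have h3 : (i.1 : ℤ) + 1 ≤ K := by exact_mod_cast i.2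
      have h4 : 0 ≤ (K : ℤ) * r := by positivity
      simp
      ring_nf
      fin_cases a <;> simp <;> constructor <;> linarith

theorem Q.zero {K : ℕ} : Q (Fin K × Fin 2) 0 :=
  ⟨Fin 0, inferInstance, Fin.elim0, Fin.elim0, Fin.elim0, ⟨fun e => e.elim0, by simp, by simp⟩,
    fun e => e.elim0, fun e => e.elim0⟩

theorem Q.addmul {K r : ℕ} (h : Q (Fin K × Fin 2) r) (t : ℕ) : Q (Fin K × Fin 2) (r + 4 * t) := by
  induction t with
  | zero => exact h
  | succ t ih => exact ih.add4

/-! Degree six. -/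

theorem net_block6 (c : ℤ) : Net (V := Fin 4) (E := Fin 12) 6
    ![2, 0, 3, 1, 3, 2, 3, 1, 1, 0, 0, 2] ![3, 2, 1, 3, 0, 0, 1, 2, 2, 3, 1, 0]
    (fun e => c + (e.1 : ℤ)) := by
  refine ⟨by decide, by decide, ?_⟩
  intro v
  fin_cases v <;> simp [Fin.sum_univ_succ] <;> ring

theorem Q.six_step {V : Type} [Fintype V] [DecidableEq V] (h : Q V 6) : Q (V ⊕ Fin 4) 6 := by
  obtain ⟨E, hE, p, q, l, hn, hi, hl⟩ := h
  refine ⟨_, _, _, _, _, hn.union (net_block6 (3 * (Fintype.card V : ℤ) + 1)), ?_, ?_⟩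
  · apply Function.Injective.sumElim hi
    · intro a b hab
      simp at hab
      exact Fin.ext hab
    · intro e a hab
      have := (hl e).2
      push_cast at this
      have hab' : l e = 3 * (Fintype.card V : ℤ) + 1 + (a.1 : ℤ) := hab
      omega
  · rintro (e | a)
    · have := hl e
      simp at this ⊢
      omega
    · have := a.2
      simp
      omega

theorem Q.six2 : Q (Fin 4) 6 := by
  refine ⟨_, _, _, _, _, net_block6 1, ?_, ?_⟩
  · intro a b hab
    simp at hab
    exact Fin.ext hab
  · intro a
    have := a.2
    simp
    omega

theorem Q.six3 : Q (Fin 6) 6 := by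
  refine ⟨Fin 18, inferInstance, ![0, 2, 5, 3, 1, 2, 1, 4, 3, 4, 1, 0, 0, 4, 3, 5, 5, 2],
    ![2, 3, 1, 1, 5, 4, 0, 2, 0, 0, 4, 3, 5, 3, 4, 1, 2, 5], fun e => 1 + (e.1 : ℤ),
    ⟨by decide, by decide, by decide⟩, ?_, ?_⟩
  · intro a b hab
    simp at hab
    exact Fin.ext hab
  · intro a
    have := a.2
    simp
    omega

theorem Q.six (K : ℕ) (hK : 2 ≤ K) : Q (Fin K × Fin 2) 6 := by
  induction K using Nat.strong_induction_on with
  | _ K ih =>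
    by_cases h2 : K = 2
    · subst h2; exact Q.six2.congr (by simp)
    by_cases h3 : K = 3
    · subst h3; exact Q.six3.congr (by simp)
    have := (ih (K - 2) (by omega) (by omega)).six_step
    refine this.congr ?_
    simp
    omega

/-! Degree three: zero-sum triples on pairs of vertices, plus possibly one `K₄`. -/

theorem net_pair3 {a b c : ℤ} (h : a + b = c) : Net (V := Fin 2) (E := Fin 3) 3
    ![0, 0, 1] ![1, 1, 0] ![a, b, c] := by
  refine ⟨by decide, by decide, ?_⟩
  intro v
  fin_cases v <;> simp [Fin.sum_univ_three] <;> linarith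

theorem net_K4 (x y z : ℤ) : Net (V := Fin 4) (E := Fin 6) 3
    ![3, 1, 2, 3, 0, 1] ![2, 3, 1, 0, 2, 0] ![x, y, z, y - x, z - x, z - y] := by
  refine ⟨by decide, by decide, ?_⟩
  intro v
  fin_cases v <;> simp [Fin.sum_univ_succ]

theorem inj3 {I : Type} {a b c : I → ℤ}
    (hi : ∀ i j, (a i = a j → i = j) ∧ (b i = b j → i = j) ∧ (c i = c j → i = j) ∧
      a i ≠ b j ∧ a i ≠ c j ∧ b i ≠ c j) :
    Function.Injective (fun x : I × Fin 3 => ![a x.1, b x.1, c x.1] x.2) := by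
  rintro ⟨i, s⟩ ⟨j, t⟩ h
  have h1 := hi i j
  have h2 := hi j i
  fin_cases s <;> fin_cases t <;> simp at h ⊢ <;> grind

theorem Q.three {I : Type} [Fintype I] [DecidableEq I] {a b c : I → ℤ} (K : ℕ)
    (hK : Fintype.card I = K) (h : ∀ i, a i + b i = c i)
    (hi : ∀ i j, (a i = a j → i = j) ∧ (b i = b j → i = j) ∧ (c i = c j → i = j) ∧
      a i ≠ b j ∧ a i ≠ c j ∧ b i ≠ c j)
    (hl : ∀ i, 1 ≤ a i ∧ 1 ≤ b i ∧ c i ≤ 3 * K) : Q (Fin K × Fin 2) 3 := by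
  have : Q (I × Fin 2) 3 := by
    refine ⟨_, _, _, _, _, Net.family (fun i => net_pair3 (h i)), inj3 hi, ?_⟩
    rintro ⟨i, s⟩
    have := hl i
    have := h i
    fin_cases s <;> simp [hK] <;> constructor <;> linarith
  exact this.congr (by simp [hK])

theorem Q.threeK {I : Type} [Fintype I] [DecidableEq I] {a b c : I → ℤ} (x y z : ℤ) (K : ℕ)
    (hK : Fintype.card I + 2 = K) (h : ∀ i, a i + b i = c i)
    (hi : ∀ i j, (a i = a j → i = j) ∧ (b i = b j → i = j) ∧ (c i = c j → i = j) ∧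
      a i ≠ b j ∧ a i ≠ c j ∧ b i ≠ c j)
    (hl : ∀ i, 1 ≤ a i ∧ 1 ≤ b i ∧ c i ≤ 3 * K)
    (hw : 1 ≤ x ∧ x < y ∧ y < z ∧ z ≤ 3 * K ∧ x ≠ y - x ∧ x ≠ z - x ∧ x ≠ z - y ∧ y ≠ z - x ∧
      y ≠ z - y ∧ y - x ≠ z - y)
    (hd : ∀ i, (a i ≠ x ∧ a i ≠ y ∧ a i ≠ z ∧ a i ≠ y - x ∧ a i ≠ z - x ∧ a i ≠ z - y) ∧
      (b i ≠ x ∧ b i ≠ y ∧ b i ≠ z ∧ b i ≠ y - x ∧ b i ≠ z - x ∧ b i ≠ z - y) ∧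
      (c i ≠ x ∧ c i ≠ y ∧ c i ≠ z ∧ c i ≠ y - x ∧ c i ≠ z - x ∧ c i ≠ z - y)) :
    Q (Fin K × Fin 2) 3 := by
  have : Q ((I × Fin 2) ⊕ Fin 4) 3 := by
    have hcard : (Fintype.card ((I × Fin 2) ⊕ Fin 4) : ℤ) = 2 * K := by
      simp; omega
    refine ⟨_, _, _, _, _, (Net.family (fun i => net_pair3 (h i))).union (net_K4 x y z), ?_, ?_⟩
    · apply Function.Injective.sumElim (inj3 hi)
      · intro s t hst
        fin_cases s <;> fin_cases t <;> first | rfl | (exfalso; simp at hst; omega)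
      · rintro ⟨i, s⟩ t hst
        have := hd i
        fin_cases s <;> fin_cases t <;> simp at hst <;> omega
    · rw [hcard]
      rintro (⟨i, s⟩ | s)
      · have := hl i
        have := h i
        fin_cases s <;> simp <;> constructor <;> linarith
      · fin_cases s <;> simp <;> constructor <;> linarith
  exact this.congr (by simp; omega)

theorem Q.three0 (s : ℕ) (hs : 2 ≤ s) : Q (Fin (4 * s) × Fin 2) 3 := by
  refine Q.three (I := Fin (2 * s) ⊕ Fin (s - 1) ⊕ Fin (s - 2) ⊕ Unit ⊕ Unit ⊕ Unit)
    (a := Sum.elim (fun i => 4 * s - 2 * i.1) <| Sum.elim (fun i => 4 * s - 3 - 2 * i.1) <|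
      Sum.elim (fun i => 2 * s - 3 - 2 * i.1) <| Sum.elim (fun _ => 4 * s - 1) <|
      Sum.elim (fun _ => 2 * s - 1) (fun _ => 1))
    (b := Sum.elim (fun i => 8 * s + i.1) <| Sum.elim (fun i => 4 * s + 1 + i.1) <|
      Sum.elim (fun i => 5 * s + 2 + i.1) <| Sum.elim (fun _ => 6 * s + 1) <|
      Sum.elim (fun _ => 6 * s) (fun _ => 5 * s))
    (c := Sum.elim (fun i => 12 * s - i.1) <| Sum.elim (fun i => 8 * s - 2 - i.1) <|
      Sum.elim (fun i => 7 * s - 1 - i.1) <| Sum.elim (fun _ => 10 * s) <|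
      Sum.elim (fun _ => 8 * s - 1) (fun _ => 5 * s + 1)) _ ?_ ?_ ?_ ?_
  · simp; omega
  · rintro (⟨i, hi⟩ | ⟨i, hi⟩ | ⟨i, hi⟩ | i | i | i) <;>
      simp only [Sum.elim_inl, Sum.elim_inr] <;> omega
  · rintro (⟨i, hi⟩ | ⟨i, hi⟩ | ⟨i, hi⟩ | i | i | i) (⟨j, hj⟩ | ⟨j, hj⟩ | ⟨j, hj⟩ | j | j | j) <;>
      simp only [Sum.elim_inl, Sum.elim_inr] <;> and_intros <;> intro h <;>
      first | rfl | omega | (simp only [Sum.inl.injEq, Sum.inr.injEq, Fin.mk.injEq]; omega)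
  · rintro (⟨i, hi⟩ | ⟨i, hi⟩ | ⟨i, hi⟩ | i | i | i) <;>
      simp only [Sum.elim_inl, Sum.elim_inr] <;> omega

theorem Q.three1 (s : ℕ) (hs : 2 ≤ s) : Q (Fin (4 * s + 1) × Fin 2) 3 := by
  refine Q.three (I := Fin (2 * s) ⊕ Fin (s - 1) ⊕ Fin (s - 2) ⊕ Unit ⊕ Unit ⊕ Unit ⊕ Unit)
    (a := Sum.elim (fun i => 4 * s - 2 * i.1) <| Sum.elim (fun i => 4 * s - 3 - 2 * i.1) <|
      Sum.elim (fun i => 2 * s - 3 - 2 * i.1) <| Sum.elim (fun _ => 1) <|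
      Sum.elim (fun _ => 5 * s + 1) <| Sum.elim (fun _ => 4 * s - 1) (fun _ => 2 * s - 1))
    (b := Sum.elim (fun i => 8 * s + i.1) <| Sum.elim (fun i => 4 * s + 2 + i.1) <|
      Sum.elim (fun i => 5 * s + 2 + i.1) <| Sum.elim (fun _ => 12 * s + 2) <|
      Sum.elim (fun _ => 7 * s) <| Sum.elim (fun _ => 6 * s + 1) (fun _ => 4 * s + 1))
    (c := Sum.elim (fun i => 12 * s - i.1) <| Sum.elim (fun i => 8 * s - 1 - i.1) <|
      Sum.elim (fun i => 7 * s - 1 - i.1) <| Sum.elim (fun _ => 12 * s + 3) <|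
      Sum.elim (fun _ => 12 * s + 1) <| Sum.elim (fun _ => 10 * s) (fun _ => 6 * s)) _ ?_ ?_ ?_ ?_
  · simp; omega
  · rintro (⟨i, hi⟩ | ⟨i, hi⟩ | ⟨i, hi⟩ | i | i | i | i) <;>
      simp only [Sum.elim_inl, Sum.elim_inr] <;> omega
  · rintro (⟨i, hi⟩ | ⟨i, hi⟩ | ⟨i, hi⟩ | i | i | i | i)
      (⟨j, hj⟩ | ⟨j, hj⟩ | ⟨j, hj⟩ | j | j | j | j) <;>
      simp only [Sum.elim_inl, Sum.elim_inr] <;> and_intros <;> intro h <;>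
      first | rfl | omega | (simp only [Sum.inl.injEq, Sum.inr.injEq, Fin.mk.injEq]; omega)
  · rintro (⟨i, hi⟩ | ⟨i, hi⟩ | ⟨i, hi⟩ | i | i | i | i) <;>
      simp only [Sum.elim_inl, Sum.elim_inr] <;> omega

theorem Q.three2 (s : ℕ) (hs : 2 ≤ s) : Q (Fin (4 * s + 2) × Fin 2) 3 := by
  refine Q.threeK (I := Fin (2 * s - 1) ⊕ Fin (2 * s - 3) ⊕ Unit ⊕ Unit ⊕ Unit ⊕ Unit)
    (a := Sum.elim (fun i => 4 * s + 2 - 2 * i.1) <| Sum.elim (fun i => 4 * s - 3 - 2 * i.1) <|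
      Sum.elim (fun _ => 3) <| Sum.elim (fun _ => 4 * s + 1) <|
      Sum.elim (fun _ => 2) (fun _ => 4))
    (b := Sum.elim (fun i => 8 * s + 2 + i.1) <| Sum.elim (fun i => 4 * s + 4 + i.1) <|
      Sum.elim (fun _ => 10 * s + 2) <| Sum.elim (fun _ => 6 * s + 3) <|
      Sum.elim (fun _ => 10 * s + 1) (fun _ => 4 * s - 1))
    (c := Sum.elim (fun i => 12 * s + 4 - i.1) <| Sum.elim (fun i => 8 * s + 1 - i.1) <|
      Sum.elim (fun _ => 10 * s + 5) <| Sum.elim (fun _ => 10 * s + 4) <|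
      Sum.elim (fun _ => 10 * s + 3) (fun _ => 4 * s + 3))
    1 (6 * s + 2) (12 * s + 6) _ ?_ ?_ ?_ ?_ ?_ ?_
  · simp; omega
  · rintro (⟨i, hi⟩ | ⟨i, hi⟩ | i | i | i | i) <;>
      simp only [Sum.elim_inl, Sum.elim_inr] <;> omega
  · rintro (⟨i, hi⟩ | ⟨i, hi⟩ | i | i | i | i)
      (⟨j, hj⟩ | ⟨j, hj⟩ | j | j | j | j) <;>
      simp only [Sum.elim_inl, Sum.elim_inr] <;> and_intros <;> intro h <;>
      first | rfl | omega | (simp only [Sum.inl.injEq, Sum.inr.injEq, Fin.mk.injEq]; omega)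
  · rintro (⟨i, hi⟩ | ⟨i, hi⟩ | i | i | i | i) <;>
      simp only [Sum.elim_inl, Sum.elim_inr] <;> omega
  · omega
  · rintro (⟨i, hi⟩ | ⟨i, hi⟩ | i | i | i | i) <;>
      simp only [Sum.elim_inl, Sum.elim_inr] <;> and_intros <;> omega

theorem Q.three3 (s : ℕ) (hs : 1 ≤ s) : Q (Fin (4 * s + 3) × Fin 2) 3 := by
  refine Q.threeK (I := Fin (2 * s + 1) ⊕ Fin s ⊕ Fin (s - 1) ⊕ Unit)
    (a := Sum.elim (fun i => 4 * s + 2 - 2 * i.1) <| Sum.elim (fun i => 4 * s + 1 - 2 * i.1) <|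
      Sum.elim (fun i => 2 * s - 1 - 2 * i.1) (fun _ => 1))
    (b := Sum.elim (fun i => 8 * s + 7 + i.1) <| Sum.elim (fun i => 4 * s + 5 + i.1) <|
      Sum.elim (fun i => 5 * s + 5 + i.1) (fun _ => 7 * s + 5))
    (c := Sum.elim (fun i => 12 * s + 9 - i.1) <| Sum.elim (fun i => 8 * s + 6 - i.1) <|
      Sum.elim (fun i => 7 * s + 4 - i.1) (fun _ => 7 * s + 6))
    (4 * s + 3) (6 * s + 4) (10 * s + 8) _ ?_ ?_ ?_ ?_ ?_ ?_
  · simp; omega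
  · rintro (⟨i, hi⟩ | ⟨i, hi⟩ | ⟨i, hi⟩ | i) <;>
      simp only [Sum.elim_inl, Sum.elim_inr] <;> omega
  · rintro (⟨i, hi⟩ | ⟨i, hi⟩ | ⟨i, hi⟩ | i) (⟨j, hj⟩ | ⟨j, hj⟩ | ⟨j, hj⟩ | j) <;>
      simp only [Sum.elim_inl, Sum.elim_inr] <;> and_intros <;> intro h <;>
      first | rfl | omega | (simp only [Sum.inl.injEq, Sum.inr.injEq, Fin.mk.injEq]; omega)
  · rintro (⟨i, hi⟩ | ⟨i, hi⟩ | ⟨i, hi⟩ | i) <;>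
      simp only [Sum.elim_inl, Sum.elim_inr] <;> omega
  · omega
  · rintro (⟨i, hi⟩ | ⟨i, hi⟩ | ⟨i, hi⟩ | i) <;>
      simp only [Sum.elim_inl, Sum.elim_inr] <;> and_intros <;> omega

theorem Q.three_all (K : ℕ) (hK : 1 ≤ K) : Q (Fin K × Fin 2) 3 := by
  by_cases h1 : K = 1
  · subst h1
    exact Q.three (I := Fin 1) (a := ![1]) (b := ![2]) (c := ![3]) 1 (by simp)
      (by decide) (by decide) (by decide)
  by_cases h4 : K = 4
  · subst h4
    exact Q.three (I := Fin 4) (a := ![1, 3, 4, 2]) (b := ![11, 7, 5, 6]) (c := ![12, 10, 9, 8]) 4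
      (by simp) (by decide) (by decide) (by decide)
  by_cases h5 : K = 5
  · subst h5
    exact Q.three (I := Fin 5) (a := ![1, 3, 4, 5, 2]) (b := ![14, 10, 8, 6, 7])
      (c := ![15, 13, 12, 11, 9]) 5 (by simp) (by decide) (by decide) (by decide)
  by_cases h2 : K = 2
  · subst h2
    exact Q.threeK (I := Fin 0) (a := ![]) (b := ![]) (c := ![]) 1 4 6 2
      (by simp) (by decide) (by decide) (by decide) (by decide) (by decide)
  by_cases h3 : K = 3
  · subst h3
    exact Q.threeK (I := Fin 1) (a := ![1]) (b := ![7]) (c := ![8]) 3 5 9 3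
      (by simp) (by decide) (by decide) (by decide) (by decide) (by decide)
  by_cases h6 : K = 6
  · subst h6
    exact Q.threeK (I := Fin 4) (a := ![5, 8, 2, 3]) (b := ![13, 9, 14, 12])
      (c := ![18, 17, 16, 15]) 1 7 11 6
      (by simp) (by decide) (by decide) (by decide) (by decide) (by decide)
  obtain ⟨s, hs⟩ : ∃ s, s = K / 4 := ⟨_, rfl⟩
  have hr : K = 4 * s ∨ K = 4 * s + 1 ∨ K = 4 * s + 2 ∨ K = 4 * s + 3 := by omega
  rcases hr with rfl | rfl | rfl | rfl
  · exact Q.three0 s (by omega)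
  · exact Q.three1 s (by omega)
  · exact Q.three2 s (by omega)
  · exact Q.three3 s (by omega)

/-! Degree five. -/

theorem net_pair5 {a b c d e : ℤ} (h : a + b + c = d + e) : Net (V := Fin 2) (E := Fin 5) 5
    ![0, 0, 0, 1, 1] ![1, 1, 1, 0, 0] ![a, b, c, d, e] := by
  refine ⟨by decide, by decide, ?_⟩
  intro v
  fin_cases v <;> simp [Fin.sum_univ_succ] <;> linarith

theorem net_block5 (h t : ℤ) : Net (V := Fin 4) (E := Fin 10) 5
    ![1, 2, 0, 1, 1, 3, 2, 0, 2, 3] ![0, 3, 1, 0, 3, 0, 1, 2, 3, 2]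
    ![1, 2, h, h + 1, t, t + 1, t + 2, t + 3, t + 4, t + 5] := by
  refine ⟨by decide, by decide, ?_⟩
  intro v
  fin_cases v <;> simp [Fin.sum_univ_succ] <;> ring

theorem inj5 {I : Type} {a b c d e : I → ℤ}
    (hi : ∀ i j, (a i = a j → i = j) ∧ (b i = b j → i = j) ∧ (c i = c j → i = j) ∧
      (d i = d j → i = j) ∧ (e i = e j → i = j) ∧
      a i ≠ b j ∧ a i ≠ c j ∧ a i ≠ d j ∧ a i ≠ e j ∧ b i ≠ c j ∧ b i ≠ d j ∧ b i ≠ e j ∧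
      c i ≠ d j ∧ c i ≠ e j ∧ d i ≠ e j) :
    Function.Injective (fun x : I × Fin 5 => ![a x.1, b x.1, c x.1, d x.1, e x.1] x.2) := by
  rintro ⟨i, s⟩ ⟨j, t⟩ h
  have h1 := hi i j
  have h2 := hi j i
  fin_cases s <;> fin_cases t <;> simp at h ⊢ <;> grind

theorem Q.fiveA (t q : ℕ) (ht : 1 ≤ t) (hq : q = 2 * t ∨ q + 1 = 2 * t) :
    Q (Fin (q + 2 * t) × Fin 2) 5 := by
  let I : Type := Unit ⊕ Fin (q - 1) ⊕ Fin t ⊕ Fin t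
  let a : I → ℤ := Sum.elim (fun _ => 2) <| Sum.elim (fun i => 2 * i.1 + 4) <|
    Sum.elim (fun i => 4 * i.1 + 1) (fun i => 4 * i.1 + 3)
  let b : I → ℤ := Sum.elim (fun _ => 2 * q + 2 * t) <|
    Sum.elim (fun i => 2 * q + 2 * t - 1 - i.1) <|
    Sum.elim (fun i => 3 * q + 4 * t - 2 * i.1) (fun i => 3 * q + 4 * t - 1 - 2 * i.1)
  let c : I → ℤ := Sum.elim (fun _ => 3 * q + 4 * t + 1) <|
    Sum.elim (fun i => 3 * q + 6 * t + 3 + 2 * i.1) <|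
    Sum.elim (fun i => 5 * q + 6 * t + 3 + 4 * i.1) (fun i => 5 * q + 6 * t + 4 + 4 * i.1)
  let d : I → ℤ := Sum.elim (fun _ => 2 * q + 2 * t + 1) <|
    Sum.elim (fun i => 2 * q + 2 * t + 2 + i.1) <|
    Sum.elim (fun i => 3 * q + 4 * t + 3 + 2 * i.1) (fun i => 3 * q + 4 * t + 4 + 2 * i.1)
  let e : I → ℤ := Sum.elim (fun _ => 3 * q + 4 * t + 2) <|
    Sum.elim (fun i => 3 * q + 6 * t + 4 + 2 * i.1) <|
    Sum.elim (fun i => 5 * q + 6 * t + 1 + 4 * i.1) (fun i => 5 * q + 6 * t + 2 + 4 * i.1)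
  have hK : Fintype.card I = q + 2 * t := by simp [I]; omega
  have h : ∀ i, a i + b i + c i = d i + e i := by
    rintro (i | ⟨i, hi⟩ | ⟨i, hi⟩ | ⟨i, hi⟩) <;>
      simp only [a, b, c, d, e, Sum.elim_inl, Sum.elim_inr] <;> omega
  have hl : ∀ i, (1 ≤ a i ∧ 1 ≤ b i ∧ 1 ≤ c i ∧ 1 ≤ d i ∧ 1 ≤ e i) ∧
      (a i ≤ 5 * (q + 2 * t) ∧ b i ≤ 5 * (q + 2 * t) ∧ c i ≤ 5 * (q + 2 * t) ∧
      d i ≤ 5 * (q + 2 * t) ∧ e i ≤ 5 * (q + 2 * t)) := by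
    rintro (i | ⟨i, hi⟩ | ⟨i, hi⟩ | ⟨i, hi⟩) <;>
      simp only [a, b, c, d, e, Sum.elim_inl, Sum.elim_inr] <;> omega
  have : Q (I × Fin 2) 5 := by
    refine ⟨_, _, _, _, _, Net.family (fun i => net_pair5 (h i)), inj5 ?_, ?_⟩
    · rintro (i | ⟨i, hi⟩ | ⟨i, hi⟩ | ⟨i, hi⟩) (j | ⟨j, hj⟩ | ⟨j, hj⟩ | ⟨j, hj⟩) <;>
        simp only [a, b, c, d, e, Sum.elim_inl, Sum.elim_inr] <;> and_intros <;> intro h <;>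
        first | rfl | omega | (obtain rfl : i = j := (by omega); rfl)
    · rintro ⟨i, s⟩
      have := hl i
      fin_cases s <;> simp [hK] <;> constructor <;> linarith
  exact this.congr (by simp [hK])

theorem Q.fiveB (t q : ℕ) (hq1 : 1 ≤ q) (hq : q = 2 * t + 1 ∨ q = 2 * t) :
    Q (Fin (q + 2 * t + 1) × Fin 2) 5 := by
  let I : Type := Fin (q - 1) ⊕ Fin t ⊕ Fin t
  let a : I → ℤ := Sum.elim (fun i => 2 * i.1 + 4) <|
    Sum.elim (fun i => 4 * i.1 + 3) (fun i => 4 * i.1 + 5)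
  let b : I → ℤ := Sum.elim (fun i => 2 * q + 2 * t - i.1) <|
    Sum.elim (fun i => 3 * q + 4 * t + 1 - 2 * i.1) (fun i => 3 * q + 4 * t - 2 * i.1)
  let c : I → ℤ := Sum.elim (fun i => 3 * q + 6 * t + 2 + 2 * i.1) <|
    Sum.elim (fun i => 5 * q + 6 * t + 4 * i.1) (fun i => 5 * q + 6 * t + 1 + 4 * i.1)
  let d : I → ℤ := Sum.elim (fun i => 2 * q + 2 * t + 3 + i.1) <|
    Sum.elim (fun i => 3 * q + 4 * t + 2 + 2 * i.1) (fun i => 3 * q + 4 * t + 3 + 2 * i.1)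
  let e : I → ℤ := Sum.elim (fun i => 3 * q + 6 * t + 3 + 2 * i.1) <|
    Sum.elim (fun i => 5 * q + 6 * t + 2 + 4 * i.1) (fun i => 5 * q + 6 * t + 3 + 4 * i.1)
  have hK : Fintype.card I + 1 = q + 2 * t := by simp [I]; omega
  have h : ∀ i, a i + b i + c i = d i + e i := by
    rintro (⟨i, hi⟩ | ⟨i, hi⟩ | ⟨i, hi⟩) <;>
      simp only [a, b, c, d, e, Sum.elim_inl, Sum.elim_inr] <;> omega
  have hl : ∀ i, (1 ≤ a i ∧ 1 ≤ b i ∧ 1 ≤ c i ∧ 1 ≤ d i ∧ 1 ≤ e i) ∧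
      (a i ≤ 5 * (q + 2 * t + 1) ∧ b i ≤ 5 * (q + 2 * t + 1) ∧ c i ≤ 5 * (q + 2 * t + 1) ∧
      d i ≤ 5 * (q + 2 * t + 1) ∧ e i ≤ 5 * (q + 2 * t + 1)) := by
    rintro (⟨i, hi⟩ | ⟨i, hi⟩ | ⟨i, hi⟩) <;>
      simp only [a, b, c, d, e, Sum.elim_inl, Sum.elim_inr] <;> omega
  have : Q ((I × Fin 2) ⊕ Fin 4) 5 := by
    have hcard : (Fintype.card ((I × Fin 2) ⊕ Fin 4) : ℤ) = 2 * (q + 2 * t + 1) := by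
      simp; omega
    refine ⟨_, _, _, _, _, (Net.family (fun i => net_pair5 (h i))).union
      (net_block5 (2 * q + 2 * t + 1) (5 * q + 10 * t)), ?_, ?_⟩
    · apply Function.Injective.sumElim (inj5 ?_)
      · intro s u hsu
        fin_cases s <;> fin_cases u <;> first | rfl | (exfalso; simp at hsu; done) | (exfalso; simp at hsu; omega)
      · have key : ∀ i : I, ∀ x ∈ [a i, b i, c i, d i, e i], x ≠ 1 ∧ x ≠ 2 ∧
            x ≠ 2 * q + 2 * t + 1 ∧ x ≠ 2 * q + 2 * t + 1 + 1 ∧ x < 5 * q + 10 * t := by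
          simp only [List.forall_mem_cons]
          rintro (⟨i, hi⟩ | ⟨i, hi⟩ | ⟨i, hi⟩) <;>
            simp only [a, b, c, d, e, Sum.elim_inl, Sum.elim_inr] <;> and_intros <;>
            first | omega | simp
        rintro ⟨i, s⟩ u hsu
        have hx : (![a i, b i, c i, d i, e i] s) ∈ [a i, b i, c i, d i, e i] := by
          fin_cases s <;> simp
        have hk := key i _ hx
        have hsu' : (![a i, b i, c i, d i, e i] s) = ![1, 2, (2 * q + 2 * t + 1 : ℤ),
          2 * q + 2 * t + 1 + 1, 5 * q + 10 * t, 5 * q + 10 * t + 1, 5 * q + 10 * t + 2,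
          5 * q + 10 * t + 3, 5 * q + 10 * t + 4, 5 * q + 10 * t + 5] u := hsu
        rw [hsu'] at hk
        clear hsu hsu' hx key
        fin_cases u <;> simp at hk <;> omega
      · rintro (⟨i, hi⟩ | ⟨i, hi⟩ | ⟨i, hi⟩) (⟨j, hj⟩ | ⟨j, hj⟩ | ⟨j, hj⟩) <;>
        simp only [a, b, c, d, e, Sum.elim_inl, Sum.elim_inr] <;> and_intros <;> intro h <;>
        first | rfl | omega | (obtain rfl : i = j := (by omega); rfl)
    · rw [hcard]
      rintro (⟨i, s⟩ | s)
      · have := hl i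
        fin_cases s <;> simp <;> constructor <;> linarith
      · fin_cases s <;> simp <;> omega
  exact this.congr (by simp; omega)

theorem Q.five (K : ℕ) (hK : 2 ≤ K) : Q (Fin K × Fin 2) 5 := by
  obtain ⟨s, hs⟩ : ∃ s, s = K / 4 := ⟨_, rfl⟩
  have hr : K = 4 * s ∨ K = 4 * s + 1 ∨ K = 4 * s + 2 ∨ K = 4 * s + 3 := by omega
  rcases hr with h | h | h | h
  · exact (Q.fiveA s (2 * s) (by omega) (by omega)).congr (by simp; omega)
  · exact (Q.fiveB s (2 * s) (by omega) (by omega)).congr (by simp; omega)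
  · exact (Q.fiveB s (2 * s + 1) (by omega) (by omega)).congr (by simp; omega)
  · exact (Q.fiveA (s + 1) (2 * s + 1) (by omega) (by omega)).congr (by simp; omega)

theorem smr_exists (K n r : ℕ) (h : 2 * K * r = 2 * n)
    (hc : (K = 1 ∧ (r % 4 = 0 ∨ r % 4 = 3)) ∨ (2 ≤ K ∧ 3 ≤ r)) : SMR (2 * K) n r 2 := by
  apply smr_of_Q h
  have : Q (Fin K × Fin 2) r := by
    obtain ⟨s, hs⟩ : ∃ s, s = r / 4 := ⟨_, rfl⟩
    have hr : r = 4 * s ∨ r = 4 * s + 1 ∨ r = 4 * s + 2 ∨ r = 4 * s + 3 := by omega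
    rcases hr with h | h | h | h
    · rw [h]
      simpa using Q.zero.addmul (K := K) s
    · have := (Q.five K (by omega)).addmul (s - 1)
      rwa [show 5 + 4 * (s - 1) = r by omega] at this
    · have := (Q.six K (by omega)).addmul (s - 1)
      rwa [show 6 + 4 * (s - 1) = r by omega] at this
    · have := (Q.three_all K (by omega)).addmul s
      rwa [show 3 + 4 * s = r by omega] at this
  exact this.congr (by simp; omega)

/-! Necessity. -/

theorem smr_count {m n r : ℕ} {A : Fin m → Fin n → Option ℤ} (h : IsSMR m n r 2 A) :
    m * r = 2 * n := by
  obtain ⟨h1, h2, -⟩ := h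
  have e1 : ∑ i : Fin m, ∑ j : Fin n, (if (A i j).isSome then 1 else 0) = m * r := by
    simp only [← Finset.card_filter, h1]; simp
  rw [Finset.sum_comm] at e1
  simp only [← Finset.card_filter, h2] at e1
  simp at e1
  omega

theorem smr_value {m n r : ℕ} {A : Fin m → Fin n → Option ℤ} (h : IsSMR m n r 2 A) (x : ℤ) :
    SMRvalue m r 2 x ↔ x ≠ 0 ∧ |x| ≤ n := by
  have hmn := smr_count h
  have h1 : (m : ℤ) * r = 2 * n := by exact_mod_cast hmn
  have h2 : ¬ (m * r % 2 = 1) := by omega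
  unfold SMRvalue
  rw [if_neg h2, h1]
  simp

theorem smr_row {m n r : ℕ} {A : Fin m → Fin n → Option ℤ} (h : IsSMR m n r 2 A) (i : Fin m) :
    ∑ j ∈ Finset.univ.filter (fun j => (A i j).isSome), (A i j).getD 0 = 0 := by
  refine Eq.trans ?_ (h.2.2.2.2.1 i)
  apply Finset.sum_filter_of_ne
  intro j _ hj
  cases hA : A i j <;> simp_all

theorem smr_col {m n r : ℕ} {A : Fin m → Fin n → Option ℤ} (h : IsSMR m n r 2 A) (j : Fin n) :
    ∑ i ∈ Finset.univ.filter (fun i => (A i j).isSome), (A i j).getD 0 = 0 := by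
  refine Eq.trans ?_ (h.2.2.2.2.2 j)
  apply Finset.sum_filter_of_ne
  intro i _ hi
  cases hA : A i j <;> simp_all

theorem smr_opp {m n r : ℕ} {A : Fin m → Fin n → Option ℤ} (h : IsSMR m n r 2 A) {i : Fin m}
    {j : Fin n} {x : ℤ} (hx : A i j = some x) : ∃ i', i' ≠ i ∧ A i' j = some (-x) := by
  obtain ⟨u, v, huv, hs⟩ := Finset.card_eq_two.1 (h.2.1 j)
  have hsum := smr_col h j
  rw [hs, Finset.sum_pair huv] at hsum
  have hu : (A u j).isSome := by
    have : u ∈ Finset.univ.filter (fun i => (A i j).isSome) := by rw [hs]; simp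
    simpa using this
  have hv : (A v j).isSome := by
    have : v ∈ Finset.univ.filter (fun i => (A i j).isSome) := by rw [hs]; simp
    simpa using this
  have hi : i = u ∨ i = v := by
    have : i ∈ Finset.univ.filter (fun i => (A i j).isSome) := by simp [hx]
    rw [hs] at this
    simpa using this
  obtain ⟨y, hy⟩ := Option.isSome_iff_exists.1 hu
  obtain ⟨z, hz⟩ := Option.isSome_iff_exists.1 hv
  rw [hy, hz] at hsum
  simp at hsum
  rcases hi with rfl | rfl
  · refine ⟨v, huv.symm, ?_⟩
    rw [hy] at hx
    rw [hz]
    simp at hx ⊢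
    omega
  · refine ⟨u, huv, ?_⟩
    rw [hz] at hx
    rw [hy]
    simp at hx ⊢
    omega

theorem smr_three_le {m n r : ℕ} {A : Fin m → Fin n → Option ℤ} (h : IsSMR m n r 2 A)
    (hm : 1 ≤ m) (hr : 1 ≤ r) : 3 ≤ r := by
  have hnz : ∀ i j x, A i j = some x → x ≠ 0 := fun i j x hx =>
    ((smr_value h x).1 (h.2.2.1 i j x hx)).1
  by_contra hlt
  have hc : r = 1 ∨ r = 2 := by omega
  let i : Fin m := ⟨0, hm⟩
  have hrow := smr_row h i
  have hcard := h.1 i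
  have hmem : ∀ j, j ∈ Finset.univ.filter (fun j => (A i j).isSome) → ∃ x, A i j = some x := by
    intro j hj
    exact Option.isSome_iff_exists.1 (by simpa using hj)
  rcases hc with rfl | rfl
  · obtain ⟨u, hu⟩ := Finset.card_eq_one.1 hcard
    rw [hu] at hmem hrow
    obtain ⟨x, hx⟩ := hmem u (by simp)
    simp [hx] at hrow
    exact hnz _ _ _ hx hrow
  · obtain ⟨u, v, huv, hs⟩ := Finset.card_eq_two.1 hcard
    rw [hs] at hmem hrow
    obtain ⟨x, hx⟩ := hmem u (by simp)
    obtain ⟨y, hy⟩ := hmem v (by simp)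
    rw [Finset.sum_pair huv, hx, hy] at hrow
    simp at hrow
    obtain ⟨i', hi', hA⟩ := smr_opp h hx
    rw [show -x = y by omega] at hA
    obtain ⟨p, hp, hup⟩ := h.2.2.2.1 y (h.2.2.1 _ _ _ hy)
    have e1 := hup (i', u) hA
    have e2 := hup (i, v) hy
    exact hi' (Prod.ext_iff.1 (e1.trans e2.symm)).1

theorem smr_two {n r : ℕ} {A : Fin 2 → Fin n → Option ℤ} (h : IsSMR 2 n r 2 A) :
    n % 4 = 0 ∨ n % 4 = 3 := by
  have hsome : ∀ i j, ∃ x, A i j = some x := by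
    intro i j
    have h2 := h.2.1 j
    have : Finset.univ.filter (fun i => (A i j).isSome) = Finset.univ := by
      apply Finset.eq_univ_of_card
      rw [h2]; simp
    have hi : i ∈ Finset.univ.filter (fun i => (A i j).isSome) := by rw [this]; simp
    exact Option.isSome_iff_exists.1 (by simpa using hi)
  choose B hB using hsome
  have hopp : ∀ j, A 1 j = some (-(B 0 j)) := by
    intro j
    obtain ⟨i', hi', hA⟩ := smr_opp h (hB 0 j)
    have : i' = 1 := by omega
    rw [← this, hA]
  have huniq : ∀ p p' : Fin 2 × Fin n, ∀ x, A p.1 p.2 = some x → A p'.1 p'.2 = some x → p = p' := by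
    intro p p' x hp hp'
    obtain ⟨w, -, hw⟩ := h.2.2.2.1 x (h.2.2.1 _ _ _ hp)
    rw [hw p hp, hw p' hp']
  have hinj : Function.Injective (fun j => (B 0 j).natAbs) := by
    intro j k hjk
    rcases Int.natAbs_eq_natAbs_iff.1 hjk with e | e
    · have := huniq (0, j) (0, k) (B 0 j) (hB 0 j) (by rw [e]; exact hB 0 k)
      exact (Prod.ext_iff.1 this).2
    · have := huniq (0, j) (1, k) (B 0 j) (hB 0 j) (by rw [e]; exact hopp k)
      simp at this
  have himg : Finset.univ.image (fun j => (B 0 j).natAbs) = Finset.Icc 1 n := by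
    apply Finset.eq_of_subset_of_card_le
    · intro y hy
      obtain ⟨j, -, rfl⟩ := Finset.mem_image.1 hy
      have := (smr_value h _).1 (h.2.2.1 _ _ _ (hB 0 j))
      rw [abs_le] at this
      simp only [Finset.mem_Icc]
      omega
    · rw [Finset.card_image_of_injective _ hinj]
      simp
  have hS : ∑ j, (B 0 j).natAbs = ∑ y ∈ Finset.Icc 1 n, y := by
    rw [← himg, Finset.sum_image (fun a _ b _ hab => hinj hab)]
  have hrow : ∑ j, B 0 j = 0 := by
    have := h.2.2.2.2.1 0
    simpa [hB] using this
  have heven : Even (∑ j, (B 0 j).natAbs) := by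
    have : ((∑ j, (B 0 j).natAbs : ℕ) : ZMod 2) = ((∑ j, B 0 j : ℤ) : ZMod 2) := by
      push_cast
      refine Finset.sum_congr rfl fun j _ => ?_
      rcases Int.natAbs_eq (B 0 j) with e | e
      · conv_rhs => rw [e]
        simp
      · conv_rhs => rw [e]
        simp [ZMod.neg_eq_self_mod_two]
    rw [hrow, Int.cast_zero] at this
    exact (ZMod.natCast_eq_zero_iff_even).1 this
  have hG : (∑ y ∈ Finset.Icc 1 n, y) * 2 = (n + 1) * n := by
    have h0 := Finset.sum_range_id_mul_two (n + 1)
    rw [Finset.sum_range_eq_add_Ico _ (Nat.succ_pos n)] at h0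
    simpa [Finset.Ico_add_one_right_eq_Icc] using h0
  rw [hS] at heven
  obtain ⟨w, hw⟩ := heven
  rw [hw] at hG
  have hmod : ((n + 1) * n) % 4 = 0 := by omega
  rw [Nat.mul_mod, Nat.add_mod] at hmod
  have : n % 4 < 4 := Nat.mod_lt _ (by norm_num)
  interval_cases hn : n % 4 <;> simp_all

theorem stmt_18 (m n r : ℕ) (hm : Even m) (hm1 : 1 ≤ m) (hn1 : 1 ≤ n) (hr1 : 1 ≤ r) :
    SMR m n r 2 ↔
      (m = 2 ∧ n = r ∧ (r % 4 = 0 ∨ r % 4 = 3)) ∨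
      (4 ≤ m ∧ 3 ≤ r ∧ m * r = 2 * n) := by
  obtain ⟨K, hK⟩ := hm
  constructor
  · rintro ⟨A, hA⟩
    have hc := smr_count hA
    by_cases h2 : m = 2
    · subst h2
      left
      have := smr_two hA
      have hnr : n = r := by omega
      exact ⟨rfl, hnr, hnr ▸ this⟩
    · right
      exact ⟨by omega, smr_three_le hA hm1 hr1, hc⟩
  · have e : m = 2 * K := by omega
    subst e
    rintro (⟨h1, h2, h3⟩ | ⟨h1, h2, h3⟩)
    · refine smr_exists K n r ?_ (Or.inl ⟨by omega, h3⟩)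
      rw [h1, h2]
    · exact smr_exists K n r h3 (Or.inr ⟨by omega, h2⟩)
end
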